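/- Let G be 3-edge-connected with DFS tree T rooted at r, and let u, v be vertices with v ≠ r, u a descendant of v, and B(v) = B(u) ⊔ {e} for a back-edge e. Then for every k > 2 such that c_k(M(v)) is defined, low1(c_k(M(v))) ≥ v; that is, at most two children of M(v) have their low1 point below v. -/

import Mathlib

/-- An undirected multigraph `G` (parallel edges allowed, no self-loops) together with a
DFS spanning tree `T` rooted at `root`, where the vertices are identified with their DFS
preorder numbers (so they are `Fin n`, and the root gets the smallest number).
Tree edges are oriented from child to parent and back-edges from descendant to
(proper) ancestor. -/
structure DFSGraph where
  /-- number of vertices; the vertices are `Fin n`, numbered in DFS preorder -/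
  n : ℕ
  /-- the type indexing the edges (parallel edges are allowed) -/
  Edge : Type
  edgeFintype : Fintype Edge
  /-- the first endpoint (the descendant end) of each edge -/
  fst : Edge → Fin n
  /-- the second endpoint (the ancestor end) of each edge -/
  snd : Edge → Fin n
  /-- no self-loops -/
  noloop : ∀ e, fst e ≠ snd e
  /-- the root `r` of the DFS tree -/
  root : Fin n
  /-- in DFS preorder the root gets the smallest number -/
  root_le : ∀ v, root ≤ v
  /-- the parent function `p` of the DFS tree (arbitrary at the root) -/
  parent : Fin n → Fin n
  /-- the parent of a non-root vertex precedes it in preorder -/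
  parent_lt : ∀ v, v ≠ root → parent v < v
  /-- `tEdge v` is the tree edge `(v, p(v))`, for `v ≠ root` -/
  tEdge : Fin n → Edge
  tEdge_fst : ∀ v, v ≠ root → fst (tEdge v) = v
  tEdge_snd : ∀ v, v ≠ root → snd (tEdge v) = parent v
  tEdge_inj : ∀ u v, u ≠ root → v ≠ root → tEdge u = tEdge v → u = v
  /-- DFS property: every non-tree edge is a back-edge, i.e. it joins a vertex to an
  ancestor of it (a proper ancestor, by `noloop`) -/
  back_anc : ∀ e, (¬ ∃ v, v ≠ root ∧ e = tEdge v) →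
    Relation.ReflTransGen (fun x y => x ≠ root ∧ y = parent x) (fst e) (snd e)
  /-- preorder property: the descendants of any vertex form an interval of preorder
  numbers starting at that vertex -/
  preorder_interval : ∀ v u w : Fin n, v ≤ u → u ≤ w →
    Relation.ReflTransGen (fun x y => x ≠ root ∧ y = parent x) w v →
    Relation.ReflTransGen (fun x y => x ≠ root ∧ y = parent x) u v

namespace DFSGraph

variable (G : DFSGraph)

/-- `Anc a b`: `a` is an ancestor of `b` in `T` (every vertex is an ancestor of itself). -/
def Anc (a b : Fin G.n) : Prop :=
  Relation.ReflTransGen (fun x y => x ≠ G.root ∧ y = G.parent x) b a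

/-- `PAnc a b`: `a` is a proper ancestor of `b` in `T`. -/
def PAnc (a b : Fin G.n) : Prop := G.Anc a b ∧ a ≠ b

/-- `e` is an edge of the spanning tree `T`. -/
def IsTreeEdge (e : G.Edge) : Prop := ∃ v, v ≠ G.root ∧ e = G.tEdge v

/-- `e` is a back-edge (an edge of `G ∖ T`). -/
def IsBack (e : G.Edge) : Prop := ¬ G.IsTreeEdge e

/-- `B v`: the set of back-edges `(x, y)` with `x` a descendant of `v` and `y` a proper
ancestor of `v`. -/
def B (v : Fin G.n) : Set G.Edge :=
  {e | G.IsBack e ∧ G.Anc v (G.fst e) ∧ G.PAnc (G.snd e) v}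

/-- `b_count(v) = |B(v)|`. -/
noncomputable def bcount (v : Fin G.n) : ℕ := (G.B v).ncard

/-- adjacency in `G` after removing the edge set `S` -/
def AdjOff (S : Set G.Edge) (x y : Fin G.n) : Prop :=
  ∃ e, e ∉ S ∧ ((G.fst e = x ∧ G.snd e = y) ∨ (G.fst e = y ∧ G.snd e = x))

/-- `G ∖ S` is connected -/
def ConnectedOff (S : Set G.Edge) : Prop :=
  ∀ x y, Relation.ReflTransGen (G.AdjOff S) x y

/-- `S` is an edge cut of `G`: removing `S` disconnects `G`. -/
def IsCut (S : Set G.Edge) : Prop := ¬ G.ConnectedOff S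

/-- `G` is `k`-edge-connected: it has no cut of fewer than `k` edges. -/
def EdgeConn (k : ℕ) : Prop := ∀ S : Set G.Edge, S.ncard < k → ¬ G.IsCut S

/-- `IsLow1 v y`: `y = low1(v) = min {y | ∃ (x,y) ∈ B(v)}`. -/
def IsLow1 (v y : Fin G.n) : Prop :=
  (∃ e ∈ G.B v, G.snd e = y) ∧ ∀ e ∈ G.B v, y ≤ G.snd e

/-- `IsHigh v y`: `y = high(v) = max {y | ∃ (x,y) ∈ B(v)}`. -/
def IsHigh (v y : Fin G.n) : Prop :=
  (∃ e ∈ G.B v, G.snd e = y) ∧ ∀ e ∈ G.B v, G.snd e ≤ y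

/-- `IsLow2 v y`: `y = low2(v)`, the minimum lower end of the back-edges in `B(v)` minus
one (fixed, but arbitrary) back-edge `(low1D(v), low1(v))` attaining `low1(v)`. -/
def IsLow2 (v y : Fin G.n) : Prop :=
  ∃ f ∈ G.B v, (∀ g ∈ G.B v, G.snd f ≤ G.snd g) ∧
    (∃ e ∈ G.B v, e ≠ f ∧ G.snd e = y) ∧
    (∀ e ∈ G.B v, e ≠ f → y ≤ G.snd e)

/-- `IsL1 v y`: `y = l1(v) = min ({y | (v,y) is a back-edge} ∪ {v})`. -/
def IsL1 (v y : Fin G.n) : Prop :=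
  (y = v ∨ ∃ e, G.IsBack e ∧ G.fst e = v ∧ G.snd e = y) ∧
  y ≤ v ∧ (∀ e, G.IsBack e → G.fst e = v → y ≤ G.snd e)

/-- `IsL2 v y`: `y = l2(v)`, defined as `l1(v)` but after removing one (fixed, but
arbitrary) back-edge `(v, l1(v))` attaining `l1(v)`, if such a back-edge exists. -/
def IsL2 (v y : Fin G.n) : Prop :=
  ((¬ ∃ e, G.IsBack e ∧ G.fst e = v) ∧ y = v) ∨
  (∃ f, G.IsBack f ∧ G.fst f = v ∧
    (∀ g, G.IsBack g → G.fst g = v → G.snd f ≤ G.snd g) ∧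
    (y = v ∨ ∃ e, G.IsBack e ∧ G.fst e = v ∧ e ≠ f ∧ G.snd e = y) ∧
    y ≤ v ∧
    (∀ e, G.IsBack e → G.fst e = v → e ≠ f → y ≤ G.snd e))

/-- `z` is the nearest common ancestor of the set of vertices `S`. -/
def IsNCA (S : Set (Fin G.n)) (z : Fin G.n) : Prop :=
  (∀ x ∈ S, G.Anc z x) ∧ ∀ z', (∀ x ∈ S, G.Anc z' x) → G.Anc z' z

/-- `IsM v m`: `m = M(v)`, the nearest common ancestor of all higher ends of back-edges
in `B(v)`. -/
def IsM (v m : Fin G.n) : Prop :=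
  G.IsNCA {x | ∃ e ∈ G.B v, G.fst e = x} m

/-- `IsMtilde v m`: `m = M̃(v)`, the nearest common ancestor of all higher ends of
back-edges in `B(v)` that are proper descendants of `M(v)` (defined only if such a
higher end exists). -/
def IsMtilde (v m : Fin G.n) : Prop :=
  ∃ mv, G.IsM v mv ∧
    {x | ∃ e ∈ G.B v, G.fst e = x ∧ G.PAnc mv x}.Nonempty ∧
    G.IsNCA {x | ∃ e ∈ G.B v, G.fst e = x ∧ G.PAnc mv x} m

/-- `c` is a child of `p` in `T`. -/
def IsChild (p c : Fin G.n) : Prop := c ≠ G.root ∧ G.parent c = p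

/-- `low1(c) ≤ low1(c')` (stated relationally). -/
def Low1LE (c c' : Fin G.n) : Prop :=
  ∀ y y', G.IsLow1 c y → G.IsLow1 c' y' → y ≤ y'

/-- `c = c₁(p)`: `c` is a `low1` child of `p`, i.e. a child of `p` minimizing `low1`. -/
def IsC1 (p c : Fin G.n) : Prop :=
  G.IsChild p c ∧ ∀ c', G.IsChild p c' → G.Low1LE c c'

/-- `c = c₂(p)`: `c` is a `low2` child of `p`, i.e. a child of `p` minimizing `low1`
among the children different from the (fixed) `low1` child. -/
def IsC2 (p c : Fin G.n) : Prop :=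
  ∃ c1, G.IsC1 p c1 ∧ G.IsChild p c ∧ c ≠ c1 ∧
    ∀ c', G.IsChild p c' → c' ≠ c1 → G.Low1LE c c'

/-- `c = c₃(p)`: `c` is a `low3` child of `p`. -/
def IsC3 (p c : Fin G.n) : Prop :=
  ∃ c1 c2, G.IsC1 p c1 ∧
    (G.IsChild p c2 ∧ c2 ≠ c1 ∧ ∀ c', G.IsChild p c' → c' ≠ c1 → G.Low1LE c2 c') ∧
    G.IsChild p c ∧ c ≠ c1 ∧ c ≠ c2 ∧
    (∀ c', G.IsChild p c' → c' ≠ c1 → c' ≠ c2 → G.Low1LE c c')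

/-- `IsMlow1 v m`: `m = M_low1(v)`, the nearest common ancestor of all higher ends of
back-edges in `B(v)` that are descendants of the `low1` child of `M(v)` (defined only
if such a higher end exists). -/
def IsMlow1 (v m : Fin G.n) : Prop :=
  ∃ mv c1, G.IsM v mv ∧ G.IsC1 mv c1 ∧
    {x | ∃ e ∈ G.B v, G.fst e = x ∧ G.Anc c1 x}.Nonempty ∧
    G.IsNCA {x | ∃ e ∈ G.B v, G.fst e = x ∧ G.Anc c1 x} m

/-- `IsMlow2 v m`: `m = M_low2(v)`, the nearest common ancestor of all higher ends of
back-edges in `B(v)` that are descendants of the `low2` child of `M(v)` (defined only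
if such a higher end exists). -/
def IsMlow2 (v m : Fin G.n) : Prop :=
  ∃ mv c2, G.IsM v mv ∧ G.IsC2 mv c2 ∧
    {x | ∃ e ∈ G.B v, G.fst e = x ∧ G.Anc c2 x}.Nonempty ∧
    G.IsNCA {x | ∃ e ∈ G.B v, G.fst e = x ∧ G.Anc c2 x} m

/-- `IsNextM v w`: `w = nextM(v)`, the maximum vertex `w < v` with `M(w) = M(v)`. -/
def IsNextM (v w : Fin G.n) : Prop :=
  ∃ m, G.IsM v m ∧ G.IsM w m ∧ w < v ∧ ∀ w', w' < v → G.IsM w' m → w' ≤ w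

/-- `IsLowM v l`: `l = low_M(v) = min {y | ∃ (x,y) ∈ B(v) ∖ B(nextM(v))}`. -/
def IsLowM (v l : Fin G.n) : Prop :=
  ∃ w, G.IsNextM v w ∧ (∃ e ∈ G.B v, e ∉ G.B w ∧ G.snd e = l) ∧
    ∀ e ∈ G.B v, e ∉ G.B w → l ≤ G.snd e

end DFSGraph

namespace DFSGraph

variable {G : DFSGraph}

theorem Anc.trans {a b c : Fin G.n} (hab : G.Anc a b) (hbc : G.Anc b c) : G.Anc a c :=
  Relation.ReflTransGen.trans hbc hab

theorem Anc.le {a b : Fin G.n} (h : G.Anc a b) : a ≤ b := by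
  induction h with
  | refl => exact le_rfl
  | tail _ hstep ih =>
    obtain ⟨hne, rfl⟩ := hstep
    exact (G.parent_lt _ hne).le.trans ih

theorem Anc.total {a b x : Fin G.n} (ha : G.Anc a x) (hb : G.Anc b x) :
    G.Anc a b ∨ G.Anc b a := by
  refine (Relation.ReflTransGen.total_of_right_unique ?_ ha hb).symm
  rintro x y z ⟨_, rfl⟩ ⟨_, rfl⟩
  rfl

theorem IsChild.anc {p c : Fin G.n} (hc : G.IsChild p c) : G.Anc p c :=
  Relation.ReflTransGen.single ⟨hc.1, hc.2.symm⟩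

theorem IsChild.lt {p c : Fin G.n} (hc : G.IsChild p c) : p < c :=
  hc.2 ▸ G.parent_lt c hc.1

/-- An ancestor of a child `c` of `p` is `c` itself or an ancestor of `p`. -/
theorem Anc.eq_or_anc_of_isChild {a p c : Fin G.n} (h : G.Anc a c) (hc : G.IsChild p c) :
    a = c ∨ G.Anc a p := by
  rcases Relation.ReflTransGen.cases_head h with h | ⟨q, ⟨_, rfl⟩, hq⟩
  · exact .inl h.symm
  · exact .inr (hc.2 ▸ hq)

/-- The subtrees of distinct children of a vertex are disjoint. -/
theorem IsChild.eq_of_anc {p c d x : Fin G.n} (hc : G.IsChild p c) (hd : G.IsChild p d)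
    (hcx : G.Anc c x) (hdx : G.Anc d x) : c = d := by
  rcases hcx.total hdx with h | h
  · exact (h.eq_or_anc_of_isChild hd).resolve_right fun h' => hc.lt.not_ge h'.le
  · exact ((h.eq_or_anc_of_isChild hc).resolve_right fun h' => hd.lt.not_ge h'.le).symm

/-- A common ancestor of vertices below two distinct children of `p` is an ancestor of `p`. -/
theorem IsChild.anc_of_anc_of_anc {p c d x y u : Fin G.n} (hc : G.IsChild p c)
    (hd : G.IsChild p d) (hcd : c ≠ d) (hcx : G.Anc c x) (hdy : G.Anc d y)
    (hux : G.Anc u x) (huy : G.Anc u y) : G.Anc u p := by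
  have hcu : ¬ G.Anc c u := fun h => hcd (hc.eq_of_anc hd (h.trans huy) hdy)
  rcases (hux.total hcx).resolve_right hcu |>.eq_or_anc_of_isChild hc with rfl | h
  · exact absurd .refl hcu
  · exact h

theorem IsM.anc {v m : Fin G.n} (hm : G.IsM v m) : G.Anc v m :=
  hm.2 v fun _ ⟨_, hf, hfx⟩ => hfx ▸ hf.2.1

/-- If a child `c` of a descendant of `v` has its `low1` point below `v`, then some
back-edge of `B v` starts in the subtree of `c`. -/
theorem IsChild.exists_mem_B {v m c : Fin G.n} (hc : G.IsChild m c) (hvm : G.Anc v m)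
    (hlow : ∃ y, G.IsLow1 c y ∧ y < v) : ∃ f ∈ G.B v, G.Anc c (G.fst f) := by
  obtain ⟨_, ⟨⟨f, ⟨hback, hcf, hfc⟩, rfl⟩, -⟩, hlt⟩ := hlow
  have hvc := hvm.trans hc.anc
  exact ⟨f, ⟨hback, hvc.trans hcf,
    (hfc.1.total hvc).resolve_right fun h => hlt.not_ge h.le, hlt.ne⟩, hcf⟩

/-- If `u` is a descendant of `v` and an ancestor of `M(v)`, then `B v ⊆ B u`. -/
theorem IsM.B_subset {u v m : Fin G.n} (hm : G.IsM v m) (hvu : G.Anc v u)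
    (hum : G.Anc u m) : G.B v ⊆ G.B u := fun f hf =>
  ⟨hf.1, hum.trans (hm.1 _ ⟨f, hf, rfl⟩), hf.2.2.1.trans hvu,
    ((lt_of_le_of_ne hf.2.2.1.le hf.2.2.2).trans_le hvu.le).ne⟩

end DFSGraph

/-- Let `G` be `3`-edge-connected with DFS tree `T` rooted at `r`, and
let `u, v` be vertices with `v ≠ r`, `u` a descendant of `v`, and `B(v) = B(u) ⊔ {e}`
for a back-edge `e`. Then for every `k > 2` such that `c_k(M(v))` is defined,
`low1(c_k(M(v))) ≥ v`; that is, at most two children of `M(v)` have their `low1` point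
below `v`. -/
theorem stmt15 (G : DFSGraph) (h3 : G.EdgeConn 3) (u v mv : Fin G.n)
    (hv : v ≠ G.root) (hanc : G.Anc v u) (e : G.Edge)
    (he : G.IsBack e) (heu : e ∉ G.B u) (hB : G.B v = insert e (G.B u))
    (hmv : G.IsM v mv) :
    ∀ c1 c2 c3 : Fin G.n, G.IsChild mv c1 → G.IsChild mv c2 → G.IsChild mv c3 →
      (∃ y, G.IsLow1 c1 y ∧ y < v) → (∃ y, G.IsLow1 c2 y ∧ y < v) →
      (∃ y, G.IsLow1 c3 y ∧ y < v) →
      c1 = c2 ∨ c1 = c3 ∨ c2 = c3 := by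
  intro c1 c2 c3 h1 h2 h3' l1 l2 l3
  have key : ∀ {c d : Fin G.n} {f g : G.Edge}, G.IsChild mv c → G.IsChild mv d → c ≠ d →
      G.Anc c (G.fst f) → G.Anc d (G.fst g) → f ∈ G.B u → g ∈ G.B u → False := by
    intro c d f g hc hd hcd hcf hdg hf hg
    have hum := hc.anc_of_anc_of_anc hd hcd hcf hdg hf.2.1 hg.2.1
    exact heu (hmv.B_subset hanc hum (hB ▸ Set.mem_insert e _))
  obtain ⟨f1, hf1, a1⟩ := h1.exists_mem_B hmv.anc l1
  obtain ⟨f2, hf2, a2⟩ := h2.exists_mem_B hmv.anc l2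
  obtain ⟨f3, hf3, a3⟩ := h3'.exists_mem_B hmv.anc l3
  by_contra! hne
  obtain ⟨n12, n13, n23⟩ := hne
  rw [hB] at hf1 hf2 hf3
  rcases hf1 with rfl | hf1
  · rcases hf2 with rfl | hf2
    · exact n12 (h1.eq_of_anc h2 a1 a2)
    · rcases hf3 with rfl | hf3
      · exact n13 (h1.eq_of_anc h3' a1 a3)
      · exact key h2 h3' n23 a2 a3 hf2 hf3
  · rcases hf2 with rfl | hf2
    · rcases hf3 with rfl | hf3
      · exact n23 (h2.eq_of_anc h3' a2 a3)
      · exact key h1 h3' n13 a1 a3 hf1 hf3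
    · exact key h1 h2 n12 a1 a2 hf1 hf2
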